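/- Under (H1), let ψ_t[h] denote, for each bounded measurable h : D×V → [0,∞), the unique solution of the mild NTE with initial datum h that is uniformly bounded on D×V×[0,T] for every T > 0. Then the expectation semigroup property holds: for every bounded measurable g : D×V → [0,∞) and all s, t ≥ 0, ψ_{t+s}[g] = ψ_t[ψ_s[g]] pointwise on D×V. -/

import Mathlib

open MeasureTheory Set
open scoped ENNReal

noncomputable section

/-- Points/velocities live in `ℝ³`. -/
abbrev Pt : Type := EuclideanSpace ℝ (Fin 3)

/-- The velocity space `V = {υ ∈ ℝ³ : vmin ≤ ‖υ‖ ≤ vmax}`. -/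
def Vel (vmin vmax : ℝ) : Set Pt := {υ : Pt | vmin ≤ ‖υ‖ ∧ ‖υ‖ ≤ vmax}

/-- The exit time `κ_{r,υ} = inf {t > 0 : r + tυ ∉ D}`. -/
def exitTime (D : Set Pt) (r υ : Pt) : ℝ := sInf {t : ℝ | 0 < t ∧ r + t • υ ∉ D}

/-- The advection semigroup `U_t[g](r,υ) = g(r+υt, υ)·1_{t < κ_{r,υ}}`. -/
def advect (D : Set Pt) (g : Pt → Pt → ℝ) (t : ℝ) (r υ : Pt) : ℝ :=
  if t < exitTime D r υ then g (r + t • υ) υ else 0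

/-- The combined backwards scatter-plus-fission operator `(S + F) f`,
extended by zero outside `D × V`. -/
def scatFis (D V : Set Pt) (σs σf : Pt → Pt → ℝ) (πs πf : Pt → Pt → Pt → ℝ)
    (f : Pt → Pt → ℝ) (r υ : Pt) : ℝ :=
  (D ×ˢ V).indicator
    (fun p : Pt × Pt =>
      σs p.1 p.2 * ((∫ υ' in V, f p.1 υ' * πs p.1 p.2 υ') - f p.1 p.2) +
      σf p.1 p.2 * ((∫ υ' in V, f p.1 υ' * πf p.1 p.2 υ') - f p.1 p.2))
    (r, υ)

/-- `g` is a nonnegative, bounded, measurable function on `Pt × Pt` (in curried form). -/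
def BddMeasNN (g : Pt → Pt → ℝ) : Prop :=
  Measurable (Function.uncurry g) ∧ (∀ r υ, 0 ≤ g r υ) ∧ ∃ M : ℝ, ∀ r υ, g r υ ≤ M

/-- `ψ` is a family of nonnegative bounded measurable functions, vanishing off `D × V`,
solving the mild neutron transport equation
`ψ_t[g] = U_t[g] + ∫₀ᵗ U_s[(S+F) ψ_{t-s}[g]] ds` pointwise on `D × V` for all `t ≥ 0`. -/
def IsMildSolution (D V : Set Pt) (σs σf : Pt → Pt → ℝ) (πs πf : Pt → Pt → Pt → ℝ)
    (g : Pt → Pt → ℝ) (ψ : ℝ → Pt → Pt → ℝ) : Prop :=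
  (∀ t : ℝ, Measurable (Function.uncurry (ψ t))) ∧
  (∀ t r υ, 0 ≤ ψ t r υ) ∧
  (∀ t : ℝ, ∃ M : ℝ, ∀ r υ, ψ t r υ ≤ M) ∧
  (∀ t r υ, (r, υ) ∉ D ×ˢ V → ψ t r υ = 0) ∧
  (∀ t : ℝ, 0 ≤ t → ∀ r υ : Pt, (r, υ) ∈ D ×ˢ V →
    ψ t r υ = advect D g t r υ +
      ∫ s in (0:ℝ)..t, advect D (scatFis D V σs σf πs πf (ψ (t - s))) s r υ)

/-- Uniform boundedness on `D × V × [0,T]` for every `T > 0`. -/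
def TimeLocBounded (ψ : ℝ → Pt → Pt → ℝ) : Prop :=
  ∀ T : ℝ, 0 < T → ∃ M : ℝ, ∀ t ∈ Icc (0:ℝ) T, ∀ r υ : Pt, ψ t r υ ≤ M

/-- The standing context of the paper: `D ⊆ ℝ³` nonempty, open, bounded, convex with
Lebesgue-null boundary; `0 < vmin < vmax`; measurable nonnegative cross-sections and
kernels, with `π_s(r,υ,·)` a probability density on `V`; and (H1): all cross-sections
and kernels uniformly bounded. -/
structure NTEContext (D : Set Pt) (vmin vmax : ℝ)
    (σs σf : Pt → Pt → ℝ) (πs πf : Pt → Pt → Pt → ℝ) : Prop where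
  D_nonempty : D.Nonempty
  D_open : IsOpen D
  D_bounded : Bornology.IsBounded D
  D_convex : Convex ℝ D
  D_frontier_null : volume (frontier D) = 0
  vmin_pos : 0 < vmin
  vmin_lt_vmax : vmin < vmax
  σs_meas : Measurable (Function.uncurry σs)
  σf_meas : Measurable (Function.uncurry σf)
  πs_meas : Measurable fun p : Pt × Pt × Pt => πs p.1 p.2.1 p.2.2
  πf_meas : Measurable fun p : Pt × Pt × Pt => πf p.1 p.2.1 p.2.2
  σs_nonneg : ∀ r υ, 0 ≤ σs r υ
  σf_nonneg : ∀ r υ, 0 ≤ σf r υ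
  πs_nonneg : ∀ r υ υ', 0 ≤ πs r υ υ'
  πf_nonneg : ∀ r υ υ', 0 ≤ πf r υ υ'
  πs_prob : ∀ r ∈ D, ∀ υ ∈ Vel vmin vmax, (∫ υ' in Vel vmin vmax, πs r υ υ') = 1
  H1 : ∃ M : ℝ, (∀ r υ, σs r υ ≤ M) ∧ (∀ r υ, σf r υ ≤ M) ∧
        (∀ r υ υ', πs r υ υ' ≤ M) ∧ (∀ r υ υ', πf r υ υ' ≤ M)


open Filter Topology

lemma lt_exitTime_iff {D : Set Pt} (hDo : IsOpen D) (hDb : Bornology.IsBounded D)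
    (hDc : Convex ℝ D) {r υ : Pt} (hr : r ∈ D) (hυ : υ ≠ 0) {s : ℝ} (hs : 0 ≤ s) :
    s < exitTime D r υ ↔ r + s • υ ∈ D := by
  constructor
  · intro h
    by_contra hn
    have hs' : 0 < s := by
      rcases hs.eq_or_lt with rfl | h'
      · simp [hr] at hn
      · exact h'
    have : exitTime D r υ ≤ s := csInf_le ⟨0, fun x hx => hx.1.le⟩ ⟨hs', hn⟩
    linarith
  · intro h
    have hne : {t : ℝ | 0 < t ∧ r + t • υ ∉ D}.Nonempty := by
      obtain ⟨R, hR⟩ := hDb.exists_norm_le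
      have hυ' : 0 < ‖υ‖ := norm_pos_iff.2 hυ
      have hR0 : 0 ≤ R := (norm_nonneg _).trans (hR r hr)
      refine ⟨(2 * R + 1) / ‖υ‖, by positivity, fun hmem => ?_⟩
      have h1 := hR _ hmem
      have h2 : ‖((2 * R + 1) / ‖υ‖) • υ‖ = 2 * R + 1 := by
        rw [norm_smul, Real.norm_of_nonneg (by positivity)]
        field_simp
      have h3 := norm_sub_le (r + ((2 * R + 1) / ‖υ‖) • υ) r
      rw [add_sub_cancel_left, h2] at h3
      linarith [hR r hr]
    have hcont : Continuous fun x : ℝ => r + x • υ := by fun_prop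
    obtain ⟨ε, hε, hball⟩ := Metric.isOpen_iff.1 (hDo.preimage hcont) s h
    have hend : r + (s + ε / 2) • υ ∈ D := by
      apply hball
      simp [abs_of_pos hε]
      linarith
    have hord : OrdConnected ((fun x : ℝ => r + x • υ) ⁻¹' D) := by
      have : Convex ℝ ((AffineMap.lineMap r (r + υ) : ℝ →ᵃ[ℝ] Pt) ⁻¹' D) :=
        hDc.affine_preimage _
      have heq : (fun x : ℝ => r + x • υ) = (AffineMap.lineMap r (r + υ) : ℝ →ᵃ[ℝ] Pt) := by
        ext1 x
        simp [AffineMap.lineMap_apply, add_comm]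
      rw [heq]
      exact this.ordConnected
    refine lt_of_lt_of_le (by linarith : s < s + ε / 2) (le_csInf hne ?_)
    rintro x ⟨hx0, hxD⟩
    by_contra hlt
    exact hxD (hord.out (show (0 : ℝ) ∈ (fun x : ℝ => r + x • υ) ⁻¹' D by simpa using hr) hend
      ⟨hx0.le, (not_le.1 hlt).le⟩)

/-- The primitive of a bounded function is left-continuous, even where the function fails to be
integrable. -/
lemma tendsto_intervalIntegral_left {h : ℝ → ℝ} {t M : ℝ} (ht : 0 < t)
    (hM : ∀ τ ∈ Icc 0 t, |h τ| ≤ M) :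
    Tendsto (fun x => ∫ τ in (0 : ℝ)..x, h τ) (𝓝[<] t) (𝓝 (∫ τ in (0 : ℝ)..t, h τ)) := by
  by_cases hi : IntervalIntegrable h volume 0 t
  · have hc := intervalIntegral.continuousOn_primitive_interval' hi left_mem_uIcc
    have := hc t right_mem_uIcc
    rw [uIcc_of_le ht.le] at this
    have h2 : Tendsto (fun x => ∫ τ in (0 : ℝ)..x, h τ) (𝓝[Ioo 0 t] t)
        (𝓝 (∫ τ in (0 : ℝ)..t, h τ)) :=
      this.mono_left (nhdsWithin_mono _ Ioo_subset_Icc_self)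
    rwa [nhdsWithin_Ioo_eq_nhdsLT ht] at h2
  · have hex : ∃ a ∈ Ioo 0 t, ¬ IntervalIntegrable h volume 0 a := by
      by_contra! hall
      apply hi
      rw [intervalIntegrable_iff_integrableOn_Ioo_of_le ht.le]
      have hU : Ioo 0 t = ⋃ n : ℕ, Ioc 0 (t - t / (n + 2)) := by
        ext x
        simp only [mem_Ioo, mem_iUnion, mem_Ioc]
        constructor
        · rintro ⟨h0, h1⟩
          obtain ⟨n, hn⟩ := exists_nat_gt (t / (t - x))
          refine ⟨n, h0, ?_⟩
          have : 0 < t - x := by linarith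
          rw [div_lt_iff₀ this] at hn
          rw [le_sub_comm, div_le_iff₀ (by positivity)]
          nlinarith
        · rintro ⟨n, h0, h1⟩
          have : 0 < t / (n + 2) := by positivity
          exact ⟨h0, by linarith⟩
      have hmeas : AEStronglyMeasurable h (volume.restrict (Ioo 0 t)) := by
        rw [hU, aestronglyMeasurable_iUnion_iff]
        intro n
        have h1 : t / (n + 2) < t := by
          rw [div_lt_iff₀ (by positivity)]
          nlinarith [(Nat.cast_nonneg n : (0 : ℝ) ≤ n)]
        have h2 : 0 < t / (n + 2) := by positivity
        exact (hall (t - t / (n + 2)) ⟨by linarith, by linarith⟩).1.aestronglyMeasurable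
      refine IntegrableOn.of_bound (by simp) hmeas M ?_
      filter_upwards [ae_restrict_mem measurableSet_Ioo] with x hx
      exact hM x (Ioo_subset_Icc_self hx)
    obtain ⟨a, ha, hna⟩ := hex
    rw [intervalIntegral.integral_undef hi]
    refine tendsto_const_nhds.congr' ?_
    filter_upwards [Ioo_mem_nhdsLT ha.2] with x hx
    rw [intervalIntegral.integral_undef]
    exact fun hx' => hna (hx'.mono_set (by
      rw [uIcc_of_le ha.1.le, uIcc_of_le (ha.1.trans hx.1).le]
      exact Icc_subset_Icc_right hx.1.le))

section ScatterFission

variable {D : Set Pt} {vmin vmax : ℝ} {σs σf : Pt → Pt → ℝ} {πs πf : Pt → Pt → Pt → ℝ}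

lemma isClosed_Vel (vmin vmax : ℝ) : IsClosed (Vel vmin vmax) :=
  (isClosed_le continuous_const continuous_norm).inter
    (isClosed_le continuous_norm continuous_const)

lemma measurableSet_Vel (vmin vmax : ℝ) : MeasurableSet (Vel vmin vmax) :=
  (isClosed_Vel vmin vmax).measurableSet

lemma volume_Vel_lt_top (vmin vmax : ℝ) : volume (Vel vmin vmax) < ∞ := by
  refine Bornology.IsBounded.measure_lt_top ?_
  exact Metric.isBounded_closedBall.subset
    (fun υ hυ => by simpa using hυ.2 : Vel vmin vmax ⊆ Metric.closedBall 0 vmax)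

lemma scatFis_eq_zero {f : Pt → Pt → ℝ} {V : Set Pt} {r υ : Pt} (hr : r ∉ D) :
    scatFis D V σs σf πs πf f r υ = 0 :=
  indicator_of_notMem (fun h => hr h.1) _

lemma exists_abs_scatFis_le (ctx : NTEContext D vmin vmax σs σf πs πf) :
    ∃ C : ℝ, 0 ≤ C ∧ ∀ (f : Pt → Pt → ℝ) (M : ℝ), 0 ≤ M →
      (∀ r ∈ D, ∀ υ ∈ Vel vmin vmax, |f r υ| ≤ M) →
      ∀ r υ, |scatFis D (Vel vmin vmax) σs σf πs πf f r υ| ≤ C * M := by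
  obtain ⟨K, hσs, hσf, hπs, hπf⟩ := ctx.H1
  have hK : 0 ≤ K := (ctx.σs_nonneg 0 0).trans (hσs 0 0)
  set m := volume.real (Vel vmin vmax)
  have hm : 0 ≤ m := measureReal_nonneg
  refine ⟨2 * K * (K * m + 1), by positivity, fun f M hM hf r υ => ?_⟩
  by_cases hp : (r, υ) ∈ D ×ˢ Vel vmin vmax
  · have hint : ∀ π : Pt → Pt → Pt → ℝ, (∀ r υ υ', 0 ≤ π r υ υ') → (∀ r υ υ', π r υ υ' ≤ K) →
        |∫ υ' in Vel vmin vmax, f r υ' * π r υ υ'| ≤ M * K * m := by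
      intro π h0 h1
      rw [← Real.norm_eq_abs]
      refine norm_setIntegral_le_of_norm_le_const (volume_Vel_lt_top _ _) fun υ' hυ' => ?_
      rw [Real.norm_eq_abs, abs_mul, abs_of_nonneg (h0 _ _ _)]
      exact mul_le_mul (hf r hp.1 υ' hυ') (h1 _ _ _) (h0 _ _ _) hM
    have hterm : ∀ (σ : Pt → Pt → ℝ) (π : Pt → Pt → Pt → ℝ), (∀ r υ, 0 ≤ σ r υ) →
        (∀ r υ, σ r υ ≤ K) → (∀ r υ υ', 0 ≤ π r υ υ') → (∀ r υ υ', π r υ υ' ≤ K) →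
        |σ r υ * ((∫ υ' in Vel vmin vmax, f r υ' * π r υ υ') - f r υ)| ≤ K * (M * K * m + M) := by
      intro σ π h0 h1 h2 h3
      rw [abs_mul, abs_of_nonneg (h0 _ _)]
      refine mul_le_mul (h1 _ _) ?_ (abs_nonneg _) hK
      exact (abs_sub _ _).trans (add_le_add (hint π h2 h3) (hf r hp.1 υ hp.2))
    rw [scatFis, indicator_of_mem hp]
    refine (abs_add_le _ _).trans ((add_le_add
      (hterm σs πs ctx.σs_nonneg hσs ctx.πs_nonneg hπs)
      (hterm σf πf ctx.σf_nonneg hσf ctx.πf_nonneg hπf)).trans (le_of_eq ?_))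
    ring
  · rw [scatFis, indicator_of_notMem hp, abs_zero]
    positivity

lemma integrableOn_mul_kernel {f : Pt → Pt → ℝ} {π : Pt → Pt → Pt → ℝ} {M K : ℝ}
    (hf : Measurable (Function.uncurry f)) (hfM : ∀ r υ, |f r υ| ≤ M)
    (hπ : Measurable fun p : Pt × Pt × Pt => π p.1 p.2.1 p.2.2)
    (h0 : ∀ r υ υ', 0 ≤ π r υ υ') (hK : ∀ r υ υ', π r υ υ' ≤ K) (r υ : Pt) :
    IntegrableOn (fun υ' => f r υ' * π r υ υ') (Vel vmin vmax) := by
  refine IntegrableOn.of_bound (volume_Vel_lt_top _ _) ?_ (M * K) ?_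
  · have h1 : Measurable fun υ' => f r υ' := hf.comp (measurable_const.prodMk measurable_id)
    have h2 : Measurable fun υ' => π r υ υ' :=
      hπ.comp (measurable_const.prodMk (measurable_const.prodMk measurable_id))
    exact (h1.mul h2).aestronglyMeasurable
  · refine ae_of_all _ fun υ' => ?_
    rw [Real.norm_eq_abs, abs_mul, abs_of_nonneg (h0 _ _ _)]
    exact mul_le_mul (hfM _ _) (hK _ _ _) (h0 _ _ _) ((abs_nonneg _).trans (hfM r υ'))

lemma scatFis_sub (ctx : NTEContext D vmin vmax σs σf πs πf) {f g : Pt → Pt → ℝ} {M : ℝ}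
    (hf : Measurable (Function.uncurry f)) (hfM : ∀ r υ, |f r υ| ≤ M)
    (hg : Measurable (Function.uncurry g)) (hgM : ∀ r υ, |g r υ| ≤ M) (r υ : Pt) :
    scatFis D (Vel vmin vmax) σs σf πs πf (fun r υ => f r υ - g r υ) r υ =
      scatFis D (Vel vmin vmax) σs σf πs πf f r υ -
        scatFis D (Vel vmin vmax) σs σf πs πf g r υ := by
  obtain ⟨K, -, -, hπs, hπf⟩ := ctx.H1
  by_cases hp : (r, υ) ∈ D ×ˢ Vel vmin vmax
  · simp only [scatFis, indicator_of_mem hp, sub_mul]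
    rw [integral_sub (integrableOn_mul_kernel hf hfM ctx.πs_meas ctx.πs_nonneg hπs r υ)
        (integrableOn_mul_kernel hg hgM ctx.πs_meas ctx.πs_nonneg hπs r υ),
      integral_sub (integrableOn_mul_kernel hf hfM ctx.πf_meas ctx.πf_nonneg hπf r υ)
        (integrableOn_mul_kernel hg hgM ctx.πf_meas ctx.πf_nonneg hπf r υ)]
    ring
  · simp only [scatFis, indicator_of_notMem hp, sub_zero]

lemma measurable_scatFis (ctx : NTEContext D vmin vmax σs σf πs πf) {F : ℝ → Pt → Pt → ℝ}
    (hF : Measurable fun p : ℝ × Pt × Pt => F p.1 p.2.1 p.2.2) :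
    Measurable fun p : ℝ × Pt × Pt =>
      scatFis D (Vel vmin vmax) σs σf πs πf (F p.1) p.2.1 p.2.2 := by
  have hint : ∀ π : Pt → Pt → Pt → ℝ,
      (Measurable fun p : Pt × Pt × Pt => π p.1 p.2.1 p.2.2) →
      Measurable fun p : ℝ × Pt × Pt =>
        ∫ υ' in Vel vmin vmax, F p.1 p.2.1 υ' * π p.2.1 p.2.2 υ' := by
    intro π hπ
    have h1 : Measurable fun q : (ℝ × Pt × Pt) × Pt => F q.1.1 q.1.2.1 q.2 :=
      hF.comp (by fun_prop :
        Measurable fun q : (ℝ × Pt × Pt) × Pt => (q.1.1, q.1.2.1, q.2))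
    have h2 : Measurable fun q : (ℝ × Pt × Pt) × Pt => π q.1.2.1 q.1.2.2 q.2 :=
      hπ.comp (by fun_prop :
        Measurable fun q : (ℝ × Pt × Pt) × Pt => (q.1.2.1, q.1.2.2, q.2))
    exact (h1.mul h2).stronglyMeasurable.integral_prod_right'.measurable
  have hterm : ∀ (σ : Pt → Pt → ℝ) (π : Pt → Pt → Pt → ℝ), Measurable (Function.uncurry σ) →
      (Measurable fun p : Pt × Pt × Pt => π p.1 p.2.1 p.2.2) →
      Measurable fun p : ℝ × Pt × Pt => σ p.2.1 p.2.2 *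
        ((∫ υ' in Vel vmin vmax, F p.1 p.2.1 υ' * π p.2.1 p.2.2 υ') - F p.1 p.2.1 p.2.2) :=
    fun σ π hσ hπ => (hσ.comp measurable_snd).mul ((hint π hπ).sub hF)
  exact ((hterm σs πs ctx.σs_meas ctx.πs_meas).add (hterm σf πf ctx.σf_meas ctx.πf_meas)).indicator
    (measurable_snd (ctx.D_open.measurableSet.prod (measurableSet_Vel vmin vmax)))

end ScatterFission

section MildSolution

variable {D : Set Pt} {vmin vmax : ℝ} {σs σf : Pt → Pt → ℝ} {πs πf : Pt → Pt → Pt → ℝ}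
  {g : Pt → Pt → ℝ} {ψ : ℝ → Pt → Pt → ℝ}

lemma ne_zero_of_mem_Vel (ctx : NTEContext D vmin vmax σs σf πs πf) {υ : Pt}
    (hυ : υ ∈ Vel vmin vmax) : υ ≠ 0 := by
  rintro rfl
  have := hυ.1
  rw [norm_zero] at this
  linarith [ctx.vmin_pos]

open Classical in
/-- The mild equation in characteristic form: the exit-time indicator is absorbed by the extension
by zero outside `D`, and the time integral is reversed. -/
lemma IsMildSolution.eq_characteristic (ctx : NTEContext D vmin vmax σs σf πs πf)
    (hψ : IsMildSolution D (Vel vmin vmax) σs σf πs πf g ψ) {t : ℝ} (ht : 0 ≤ t) {r υ : Pt}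
    (hr : r ∈ D) (hυ : υ ∈ Vel vmin vmax) :
    ψ t r υ = (if r + t • υ ∈ D then g (r + t • υ) υ else 0) +
      ∫ τ in (0 : ℝ)..t, scatFis D (Vel vmin vmax) σs σf πs πf (ψ τ) (r + (t - τ) • υ) υ := by
  have hex : ∀ s : ℝ, 0 ≤ s → (s < exitTime D r υ ↔ r + s • υ ∈ D) := fun s hs =>
    lt_exitTime_iff ctx.D_open ctx.D_bounded ctx.D_convex hr (ne_zero_of_mem_Vel ctx hυ) hs
  rw [hψ.2.2.2.2 t ht r υ ⟨hr, hυ⟩, advect]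
  congr 1
  · simp only [hex t ht]
  · have h1 := intervalIntegral.integral_comp_sub_left (a := 0) (b := t)
      (fun τ => scatFis D (Vel vmin vmax) σs σf πs πf (ψ τ) (r + (t - τ) • υ) υ) t
    rw [sub_self, sub_zero] at h1
    rw [← h1]
    refine intervalIntegral.integral_congr fun s hs => ?_
    rw [uIcc_of_le ht] at hs
    simp only [advect, sub_sub_cancel]
    split_ifs with h
    · rfl
    · rw [scatFis_eq_zero]
      rwa [← hex s hs.1]

lemma TimeLocBounded.exists_abs_le (hψ : IsMildSolution D (Vel vmin vmax) σs σf πs πf g ψ)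
    (hb : TimeLocBounded ψ) (T : ℝ) : ∃ M : ℝ, 0 ≤ M ∧ ∀ t ∈ Icc 0 T, ∀ r υ, |ψ t r υ| ≤ M := by
  obtain ⟨M, hM⟩ := hb (max T 1) (by positivity)
  refine ⟨max M 0, le_max_right _ _, fun t ht r υ => ?_⟩
  rw [abs_of_nonneg (hψ.2.1 t r υ)]
  exact (hM t ⟨ht.1, ht.2.trans (le_max_left _ _)⟩ r υ).trans (le_max_left _ _)

/-- Mild solutions are left-continuous in time along characteristics. No measurability in time is
needed. -/
lemma IsMildSolution.tendsto_left (ctx : NTEContext D vmin vmax σs σf πs πf)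
    (hψ : IsMildSolution D (Vel vmin vmax) σs σf πs πf g ψ) (hb : TimeLocBounded ψ) {t : ℝ}
    (ht : 0 < t) {r υ : Pt} (hr : r ∈ D) (hυ : υ ∈ Vel vmin vmax) :
    Tendsto (fun x => ψ x (r + (t - x) • υ) υ) (𝓝[<] t) (𝓝 (ψ t r υ)) := by
  classical
  obtain ⟨C, -, hC⟩ := exists_abs_scatFis_le ctx
  obtain ⟨M, hM0, hM⟩ := hb.exists_abs_le hψ t
  rw [hψ.eq_characteristic ctx ht.le hr hυ]
  refine ((tendsto_intervalIntegral_left ht (M := C * M) fun τ hτ =>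
    hC (ψ τ) M hM0 (fun r _ υ _ => hM τ hτ r υ) _ _).const_add _).congr' ?_
  have hopen : ∀ᶠ x in 𝓝[<] t, r + (t - x) • υ ∈ D := by
    have hc : ContinuousAt (fun x : ℝ => r + (t - x) • υ) t := by fun_prop
    refine (hc.eventually ?_).filter_mono nhdsWithin_le_nhds
    simpa using ctx.D_open.mem_nhds hr
  filter_upwards [hopen, Ioo_mem_nhdsLT ht] with x hx hxt
  rw [hψ.eq_characteristic ctx hxt.1.le hx hυ]
  have hadd : ∀ y : ℝ, r + (t - x) • υ + (x - y) • υ = r + (t - y) • υ := fun y => by module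
  have hadd0 : r + (t - x) • υ + x • υ = r + t • υ := by module
  simp only [hadd, hadd0]

lemma tendsto_ceil_sub_one_div_left (t : ℝ) :
    Tendsto (fun n : ℕ => ((⌈((n : ℝ) + 1) * t⌉ : ℝ) - 1) / ((n : ℝ) + 1)) atTop (𝓝[<] t) := by
  have hlt : ∀ n : ℕ, ((⌈((n : ℝ) + 1) * t⌉ : ℝ) - 1) / ((n : ℝ) + 1) < t := fun n => by
    rw [div_lt_iff₀ (by positivity)]
    linarith [Int.ceil_lt_add_one (((n : ℝ) + 1) * t)]
  refine tendsto_nhdsWithin_iff.2 ⟨?_, Eventually.of_forall hlt⟩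
  have hlow : Tendsto (fun n : ℕ => t - 1 / ((n : ℝ) + 1)) atTop (𝓝 t) := by
    simpa using tendsto_one_div_add_atTop_nhds_zero_nat.const_sub t
  refine tendsto_of_tendsto_of_tendsto_of_le_of_le hlow tendsto_const_nhds (fun n => ?_)
    fun n => (hlt n).le
  have hn : (0 : ℝ) < (n : ℝ) + 1 := by positivity
  change t - 1 / ((n : ℝ) + 1) ≤ _
  rw [le_div_iff₀ hn, sub_mul, div_mul_cancel₀ _ hn.ne']
  linarith [Int.le_ceil (((n : ℝ) + 1) * t)]

/-- Mild solutions are automatically jointly measurable in time, position and velocity. -/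
lemma IsMildSolution.measurable_indicator (ctx : NTEContext D vmin vmax σs σf πs πf)
    (hψ : IsMildSolution D (Vel vmin vmax) σs σf πs πf g ψ) (hb : TimeLocBounded ψ) :
    Measurable fun p : ℝ × Pt × Pt => (Ioi 0).indicator (fun t => ψ t p.2.1 p.2.2) p.1 := by
  set E : Set (ℝ × Pt × Pt) := Ioi 0 ×ˢ D ×ˢ Vel vmin vmax
  have hE : MeasurableSet E :=
    measurableSet_Ioi.prod (ctx.D_open.measurableSet.prod (measurableSet_Vel vmin vmax))
  let τ : ℕ → ℝ → ℝ := fun n t => ((⌈((n : ℝ) + 1) * t⌉ : ℝ) - 1) / ((n : ℝ) + 1)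
  have happrox : ∀ n : ℕ, Measurable fun p : ℝ × Pt × Pt =>
      ψ (τ n p.1) (p.2.1 + (p.1 - τ n p.1) • p.2.2) p.2.2 := by
    intro n
    have h1 : Measurable fun q : ℤ × Pt × Pt =>
        ψ (((q.1 : ℝ) - 1) / ((n : ℝ) + 1)) q.2.1 q.2.2 :=
      measurable_from_prod_countable_right fun k => hψ.1 (((k : ℝ) - 1) / ((n : ℝ) + 1))
    have h2 : Measurable fun p : ℝ × Pt × Pt => ⌈((n : ℝ) + 1) * p.1⌉ :=
      Int.measurable_ceil.comp (by fun_prop)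
    have hτ : Measurable fun p : ℝ × Pt × Pt => τ n p.1 :=
      (((measurable_from_top (f := fun k : ℤ => (k : ℝ))).comp h2).sub_const 1).div_const _
    exact h1.comp (h2.prodMk ((by fun_prop : Measurable fun p : ℝ × Pt × Pt =>
      p.2.1 + (p.1 - τ n p.1) • p.2.2).prodMk measurable_snd.snd))
  refine measurable_of_tendsto_metrizable (fun n => (happrox n).indicator hE)
    (tendsto_pi_nhds.2 ?_)
  rintro ⟨t, r, υ⟩
  by_cases hp : (t, r, υ) ∈ E
  · have ht : t ∈ Ioi (0 : ℝ) := hp.1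
    simp only [indicator_of_mem hp, indicator_of_mem ht]
    exact (hψ.tendsto_left ctx hb hp.1 hp.2.1 hp.2.2).comp (tendsto_ceil_sub_one_div_left t)
  · have h0 : (Ioi 0).indicator (fun t => ψ t r υ) t = 0 := by
      rw [indicator_apply_eq_zero]
      exact fun ht => hψ.2.2.2.1 t r υ fun h => hp ⟨ht, h⟩
    simp only [indicator_of_notMem hp, h0]
    exact tendsto_const_nhds

lemma IsMildSolution.intervalIntegrable (ctx : NTEContext D vmin vmax σs σf πs πf)
    (hψ : IsMildSolution D (Vel vmin vmax) σs σf πs πf g ψ) (hb : TimeLocBounded ψ) {a b : ℝ}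
    (ha : 0 ≤ a) (hab : a ≤ b) (c υ : Pt) (T : ℝ) :
    IntervalIntegrable
      (fun τ => scatFis D (Vel vmin vmax) σs σf πs πf (ψ τ) (c + (T - τ) • υ) υ) volume a b := by
  obtain ⟨C, -, hC⟩ := exists_abs_scatFis_le ctx
  obtain ⟨M, hM0, hM⟩ := hb.exists_abs_le hψ b
  rw [intervalIntegrable_iff_integrableOn_Ioc_of_le hab]
  refine IntegrableOn.of_bound (by simp) ?_ (C * M) ?_
  · have h1 := (measurable_scatFis ctx (F := fun t r υ => (Ioi 0).indicator (fun t => ψ t r υ) t)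
      (hψ.measurable_indicator ctx hb)).comp
      (by fun_prop : Measurable fun τ : ℝ => (τ, c + (T - τ) • υ, υ))
    refine h1.aestronglyMeasurable.congr ?_
    filter_upwards [ae_restrict_mem measurableSet_Ioc] with τ hτ
    have : τ ∈ Ioi (0 : ℝ) := ha.trans_lt hτ.1
    simp only [Function.comp, indicator_of_mem this]
  · filter_upwards [ae_restrict_mem measurableSet_Ioc] with τ hτ
    exact hC (ψ τ) M hM0 (fun r _ υ _ => hM τ ⟨ha.trans hτ.1.le, hτ.2⟩ r υ) _ _

open Classical in
/-- Restarting the equation at time `s`, in characteristic form. -/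
lemma IsMildSolution.eq_restart (ctx : NTEContext D vmin vmax σs σf πs πf)
    (hψ : IsMildSolution D (Vel vmin vmax) σs σf πs πf g ψ) (hb : TimeLocBounded ψ) {s t : ℝ}
    (hs : 0 ≤ s) (ht : 0 ≤ t) {r υ : Pt} (hr : r ∈ D) (hυ : υ ∈ Vel vmin vmax) :
    ψ (t + s) r υ = (if r + t • υ ∈ D then ψ s (r + t • υ) υ else 0) +
      ∫ τ in (0 : ℝ)..t,
        scatFis D (Vel vmin vmax) σs σf πs πf (ψ (τ + s)) (r + (t - τ) • υ) υ := by
  rw [hψ.eq_characteristic ctx (add_nonneg ht hs) hr hυ,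
    ← intervalIntegral.integral_add_adjacent_intervals
      (hψ.intervalIntegrable ctx hb le_rfl hs r υ (t + s))
      (hψ.intervalIntegrable ctx hb hs (le_add_of_nonneg_left ht) r υ (t + s)), ← add_assoc]
  congr 1
  · by_cases h : r + t • υ ∈ D
    · rw [if_pos h, hψ.eq_characteristic ctx hs h hυ]
      have hadd : ∀ y : ℝ, r + t • υ + (s - y) • υ = r + (t + s - y) • υ := fun y => by module
      have hadd0 : r + t • υ + s • υ = r + (t + s) • υ := by module
      simp only [hadd, hadd0]
    · have hout : ∀ y : ℝ, t ≤ y → r + y • υ ∉ D := fun y hy hyD => by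
        have hex := fun {x : ℝ} (hx : 0 ≤ x) => lt_exitTime_iff ctx.D_open ctx.D_bounded
          ctx.D_convex hr (ne_zero_of_mem_Vel ctx hυ) hx
        exact h ((hex ht).1 (hy.trans_lt ((hex (ht.trans hy)).2 hyD)))
      rw [if_neg h, if_neg (hout _ (le_add_of_nonneg_right hs)), zero_add]
      refine intervalIntegral.integral_zero_ae (ae_of_all _ fun τ hτ => ?_)
      rw [uIoc_of_le hs] at hτ
      exact scatFis_eq_zero (hout _ (by linarith [hτ.2]))
  · have h := intervalIntegral.integral_comp_add_right (a := 0) (b := t)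
      (fun τ => scatFis D (Vel vmin vmax) σs σf πs πf (ψ τ) (r + (t + s - τ) • υ) υ) s
    rw [zero_add] at h
    rw [← h]
    simp only [add_sub_add_right_eq_sub]

end MildSolution

section Uniqueness

variable {D : Set Pt} {vmin vmax : ℝ} {σs σf : Pt → Pt → ℝ} {πs πf : Pt → Pt → Pt → ℝ}

/-- Picard iteration: two bounded solutions of the characteristic equation with the same
inhomogeneity `A` coincide on `D × V`. -/
lemma eq_of_characteristic_eq (ctx : NTEContext D vmin vmax σs σf πs πf)
    {u w A : ℝ → Pt → Pt → ℝ} {T M : ℝ}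
    (hu : ∀ t, Measurable (Function.uncurry (u t))) (hw : ∀ t, Measurable (Function.uncurry (w t)))
    (huM : ∀ t ∈ Icc 0 T, ∀ r υ, |u t r υ| ≤ M) (hwM : ∀ t ∈ Icc 0 T, ∀ r υ, |w t r υ| ≤ M)
    (hui : ∀ t ∈ Icc 0 T, ∀ r υ, IntervalIntegrable
      (fun τ => scatFis D (Vel vmin vmax) σs σf πs πf (u τ) (r + (t - τ) • υ) υ) volume 0 t)
    (hwi : ∀ t ∈ Icc 0 T, ∀ r υ, IntervalIntegrable
      (fun τ => scatFis D (Vel vmin vmax) σs σf πs πf (w τ) (r + (t - τ) • υ) υ) volume 0 t)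
    (hue : ∀ t ∈ Icc 0 T, ∀ r ∈ D, ∀ υ ∈ Vel vmin vmax, u t r υ = A t r υ +
      ∫ τ in (0 : ℝ)..t, scatFis D (Vel vmin vmax) σs σf πs πf (u τ) (r + (t - τ) • υ) υ)
    (hwe : ∀ t ∈ Icc 0 T, ∀ r ∈ D, ∀ υ ∈ Vel vmin vmax, w t r υ = A t r υ +
      ∫ τ in (0 : ℝ)..t, scatFis D (Vel vmin vmax) σs σf πs πf (w τ) (r + (t - τ) • υ) υ)
    {t : ℝ} (ht : t ∈ Icc 0 T) {r υ : Pt} (hr : r ∈ D) (hυ : υ ∈ Vel vmin vmax) :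
    u t r υ = w t r υ := by
  obtain ⟨C, hC0, hC⟩ := exists_abs_scatFis_le ctx
  have hM0 : 0 ≤ M := (abs_nonneg _).trans (huM t ht r υ)
  have hiter : ∀ n : ℕ, ∀ t ∈ Icc 0 T, ∀ r ∈ D, ∀ υ ∈ Vel vmin vmax,
      |u t r υ - w t r υ| ≤ 2 * M * ((C * t) ^ n / n.factorial) := by
    intro n
    induction n with
    | zero =>
      intro t ht r hr υ hυ
      simp only [pow_zero, Nat.factorial_zero, Nat.cast_one, div_one, mul_one]
      linarith [abs_sub (u t r υ) (w t r υ), huM t ht r υ, hwM t ht r υ]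
    | succ n ih =>
      intro t ht r hr υ hυ
      rw [hue t ht r hr υ hυ, hwe t ht r hr υ hυ, add_sub_add_left_eq_sub,
        ← intervalIntegral.integral_sub (hui t ht r υ) (hwi t ht r υ), ← Real.norm_eq_abs]
      have hle := intervalIntegral.norm_integral_le_of_norm_le (μ := volume) (a := 0) (b := t)
        (f := fun τ => scatFis D (Vel vmin vmax) σs σf πs πf (u τ) (r + (t - τ) • υ) υ -
          scatFis D (Vel vmin vmax) σs σf πs πf (w τ) (r + (t - τ) • υ) υ)
        (g := fun τ => C * (2 * M * ((C * τ) ^ n / n.factorial))) ht.1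
        (ae_of_all _ fun τ hτ => by
          have hτT : τ ∈ Icc 0 T := ⟨hτ.1.le, hτ.2.trans ht.2⟩
          have hτ0 : 0 ≤ τ := hτT.1
          rw [← scatFis_sub ctx (hu τ) (huM τ hτT) (hw τ) (hwM τ hτT)]
          exact hC _ _ (by positivity) (ih τ hτT) _ _)
        (by apply Continuous.intervalIntegrable; fun_prop)
      refine hle.trans (le_of_eq ?_)
      have hpull : ∀ τ : ℝ, C * (2 * M * ((C * τ) ^ n / n.factorial)) =
          (C * (2 * M) * C ^ n / n.factorial) * τ ^ n := fun τ => by ring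
      simp only [hpull]
      rw [intervalIntegral.integral_const_mul, integral_pow, Nat.factorial_succ]
      push_cast
      field_simp
      ring
  have hlim : Tendsto (fun n : ℕ => 2 * M * ((C * t) ^ n / n.factorial)) atTop (𝓝 0) := by
    simpa using (FloorSemiring.tendsto_pow_div_factorial_atTop (C * t)).const_mul (2 * M)
  have h0 : |u t r υ - w t r υ| ≤ 0 :=
    ge_of_tendsto' hlim fun n => hiter n t ht r hr υ hυ
  exact sub_eq_zero.1 (abs_nonpos_iff.1 h0)

end Uniqueness

/-- Under (H1), if `Ψ h` denotes, for each bounded measurable nonnegative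
datum `h`, the unique time-locally bounded mild solution of the NTE, then the expectation
semigroup property `ψ_{t+s}[g] = ψ_t[ψ_s[g]]` holds pointwise on `D × V`. -/
theorem mild_NTE_semigroup
    (D : Set Pt) (vmin vmax : ℝ) (σs σf : Pt → Pt → ℝ) (πs πf : Pt → Pt → Pt → ℝ)
    (ctx : NTEContext D vmin vmax σs σf πs πf)
    (Ψ : (Pt → Pt → ℝ) → ℝ → Pt → Pt → ℝ)
    (hΨ : ∀ h : Pt → Pt → ℝ, BddMeasNN h →
      IsMildSolution D (Vel vmin vmax) σs σf πs πf h (Ψ h) ∧ TimeLocBounded (Ψ h))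
    (g : Pt → Pt → ℝ) (hg : BddMeasNN g)
    (s t : ℝ) (hs : 0 ≤ s) (ht : 0 ≤ t) :
    ∀ r υ : Pt, (r, υ) ∈ D ×ˢ Vel vmin vmax →
      Ψ g (t + s) r υ = Ψ (fun r' υ' => Ψ g s r' υ') t r υ := by
  classical
  obtain ⟨hψ, hψb⟩ := hΨ g hg
  have hgs : BddMeasNN (fun r' υ' => Ψ g s r' υ') := ⟨hψ.1 s, hψ.2.1 s, hψ.2.2.1 s⟩
  obtain ⟨hφ, hφb⟩ := hΨ _ hgs
  obtain ⟨M₁, -, hM₁⟩ := hψb.exists_abs_le hψ (t + s)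
  obtain ⟨M₂, -, hM₂⟩ := hφb.exists_abs_le hφ t
  rintro r υ ⟨hr, hυ⟩
  refine eq_of_characteristic_eq ctx (u := fun x => Ψ g (x + s))
    (A := fun x r υ => if r + x • υ ∈ D then Ψ g s (r + x • υ) υ else 0)
    (T := t) (M := max M₁ M₂) (fun x => hψ.1 (x + s)) hφ.1
    (fun x hx r υ => (hM₁ (x + s) ⟨add_nonneg hx.1 hs, by linarith [hx.2]⟩ r υ).trans
      (le_max_left _ _))
    (fun x hx r υ => (hM₂ x hx r υ).trans (le_max_right _ _))
    (fun x hx r υ => ?_)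
    (fun x hx r υ => hφ.intervalIntegrable ctx hφb le_rfl hx.1 r υ x)
    (fun x hx r hr υ hυ => hψ.eq_restart ctx hψb hs hx.1 hr hυ)
    (fun x hx r hr υ hυ => hφ.eq_characteristic ctx hx.1 hr hυ) ⟨ht, le_rfl⟩ hr hυ
  have h := (hψ.intervalIntegrable ctx hψb hs (le_add_of_nonneg_left hx.1) r υ
    (x + s)).comp_add_right s
  simpa only [add_sub_add_right_eq_sub, sub_self, add_sub_cancel_right] using h
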